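/- arXiv:1810.12249 — 4 statements merged into one kernel-verified Lean document; each statement's English description precedes it below -/
import Mathlib

section
/- Let d > 0 and ζ ∈ ℝ with d² > ζ. Then the cubic polynomial 2x³ + (1 − 2ζ)x − d has exactly one positive real root β, and this root satisfies 0 < β < d. -/
/-- If the cubic `2x³ + cx − d`, with `d > 0`, is nonnegative at some `x > 0`, then it is positive
at every `y > x`. -/
theorem cubic_pos_of_nonneg_of_lt {c d x y : ℝ} (hd : 0 < d) (hx : 0 < x) (hxy : x < y)
    (h : 0 ≤ 2 * x ^ 3 + c * x - d) : 0 < 2 * y ^ 3 + c * y - d := by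
  have hy : 0 < y := hx.trans hxy
  have hfactor : x * (2 * y ^ 3 + c * y - d) =
      y * (2 * x ^ 3 + c * x - d) + (y - x) * (2 * x * y * (x + y) + d) := by ring
  have hgap : 0 < y - x := sub_pos.2 hxy
  refine pos_of_mul_pos_right ?_ hx.le
  rw [hfactor]
  positivity

/-- For `d > 0` and `ζ ∈ ℝ` with `d² > ζ`, the cubic
`2x³ + (1 − 2ζ)x − d` has exactly one positive real root `β`, and this root
satisfies `0 < β < d`. -/
theorem stmt_2 (d ζ : ℝ) (hd : 0 < d) (hζ : ζ < d ^ 2) :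
    (∃! β : ℝ, 0 < β ∧ 2 * β ^ 3 + (1 - 2 * ζ) * β - d = 0) ∧
    ∀ β : ℝ, 0 < β → 2 * β ^ 3 + (1 - 2 * ζ) * β - d = 0 → β < d := by
  have hfd : 0 < 2 * d ^ 3 + (1 - 2 * ζ) * d - d := by
    have := mul_pos hd (sub_pos.2 hζ)
    linarith
  refine ⟨?_, fun β hβ hroot => ?_⟩
  · have hcont : ContinuousOn (fun x : ℝ => 2 * x ^ 3 + (1 - 2 * ζ) * x - d) (Set.Icc 0 d) := by
      fun_prop
    obtain ⟨β, hβ, hroot⟩ := intermediate_value_Ioo hd.le hcont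
      (show (0 : ℝ) ∈ Set.Ioo _ _ from ⟨by simpa using hd, hfd⟩)
    refine ⟨β, ⟨hβ.1, hroot⟩, fun γ ⟨hγ, hγroot⟩ => ?_⟩
    rcases lt_trichotomy γ β with hlt | heq | hgt
    · exact absurd hroot (cubic_pos_of_nonneg_of_lt hd hγ hlt hγroot.ge).ne'
    · exact heq
    · exact absurd hγroot (cubic_pos_of_nonneg_of_lt hd hβ.1 hgt hroot.ge).ne'
  · by_contra! hle
    rcases hle.eq_or_lt with rfl | hlt
    · exact hfd.ne' hroot
    · exact (cubic_pos_of_nonneg_of_lt hd hd hlt hfd.le).ne' hroot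
end

section
/- Let z ∈ ℝ^N, let S = {(x, η) ∈ ℝ^N × ℝ : ‖x − z‖² ≤ η}, and let (y, ζ) ∈ ℝ^N × ℝ with d := ‖y − z‖ satisfying d² > ζ. Let β be the unique positive real root of 2x³ + (1 − 2ζ)x − d = 0 and set α := β/d. Then the metric projection of (y, ζ) onto S is (α·y + (1 − α)·z, α²d²). -/
/-- `q` is the metric projection of `p` onto `S`: it belongs to `S` and minimizes the
distance to `p` among points of `S`. -/
def IsMetricProj {E : Type*} [NormedAddCommGroup E] (S : Set E) (p q : E) : Prop :=
  q ∈ S ∧ ∀ r ∈ S, dist p q ≤ dist p r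

/-- A point `q` of `S` such that `dist p q ^ 2 + dist q r ^ 2 ≤ dist p r ^ 2` for all `r ∈ S`
is the metric projection of `p`, and the only one. -/
theorem IsMetricProj.and_unique_of_sq_add_sq_le {E : Type*} [NormedAddCommGroup E] {S : Set E}
    {p q : E} (hq : q ∈ S) (h : ∀ r ∈ S, dist p q ^ 2 + dist q r ^ 2 ≤ dist p r ^ 2) :
    IsMetricProj S p q ∧ ∀ w, IsMetricProj S p w → w = q := by
  refine ⟨⟨hq, fun r hr => ?_⟩, fun w hw => ?_⟩
  · exact le_of_sq_le_sq (by nlinarith [h r hr, sq_nonneg (dist q r)]) dist_nonneg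
  · have h1 := h w hw.1
    have h2 : dist p w ^ 2 ≤ dist p q ^ 2 := by
      gcongr
      exact hw.2 q hq
    have h3 : dist q w = 0 := by
      apply pow_eq_zero_iff two_ne_zero |>.1
      nlinarith [sq_nonneg (dist q w)]
    exact (dist_eq_zero.1 h3).symm

/-- A positive root of `2x³ + (1 - 2ζ)x - d` satisfies `ζ < x²` when `ζ < d²`. -/
theorem lt_sq_of_cubic_root {ζ d β : ℝ} (hd : 0 ≤ d) (hζ : ζ < d ^ 2) (hβ : 0 < β)
    (h : 2 * β ^ 3 + (1 - 2 * ζ) * β - d = 0) : ζ < β ^ 2 := by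
  by_contra! hle
  have h1 : β < d := lt_of_pow_lt_pow_left₀ 2 hd (hle.trans_lt hζ)
  nlinarith [mul_nonneg hβ.le (sub_nonneg.2 hle)]

/-- The obtuse-angle inequality, in squared form, at the point `(a • w, b)` of the paraboloid
`‖u‖² = η`, when `(w - a • w, ζ - b)` is an outward normal there. -/
theorem sq_add_sq_le_of_normal {E : Type*} [NormedAddCommGroup E] [InnerProductSpace ℝ E]
    (w u : E) {a b ζ η : ℝ} (hb : a ^ 2 * ‖w‖ ^ 2 = b) (hζ : ζ ≤ b)
    (hnormal : 1 - a = 2 * (b - ζ) * a) (hu : ‖u‖ ^ 2 ≤ η) :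
    (‖w - a • w‖ ^ 2 + (ζ - b) ^ 2) + (‖a • w - u‖ ^ 2 + (b - η) ^ 2) ≤
      ‖w - u‖ ^ 2 + (ζ - η) ^ 2 := by
  have h1 : ‖w - a • w‖ ^ 2 = (1 - a) ^ 2 * ‖w‖ ^ 2 := by
    rw [← sq_abs (1 - a), ← Real.norm_eq_abs, ← mul_pow, ← norm_smul, sub_smul, one_smul]
  have h2 : ‖a • w - u‖ ^ 2 = b - 2 * (a * inner ℝ w u) + ‖u‖ ^ 2 := by
    rw [norm_sub_sq_real, inner_smul_left, norm_smul, mul_pow, Real.norm_eq_abs, sq_abs, hb]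
    rfl
  have h3 : 0 ≤ b - 2 * (a * inner ℝ w u) + ‖u‖ ^ 2 := h2 ▸ sq_nonneg _
  have h4 : 0 ≤ (b - ζ) * (b - 2 * (a * inner ℝ w u) + η) :=
    mul_nonneg (sub_nonneg.2 hζ) (by linarith)
  have h5 : (1 - a) * inner ℝ w u = 2 * (b - ζ) * a * inner ℝ w u := by rw [hnormal]
  have h6 : (1 - a) * a * ‖w‖ ^ 2 = 2 * (b - ζ) * b := by rw [hnormal, ← hb]; ring
  rw [h1, h2, norm_sub_sq_real w u]
  linarith

/-- Let `S = {(x, η) : ‖x − z‖² ≤ η}`, let `(y, ζ)` satisfy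
`d² > ζ` with `d := ‖y − z‖`, let `β` be the (unique) positive real root of
`2x³ + (1 − 2ζ)x − d = 0` and set `α := β/d`.  Then the metric projection of
`(y, ζ)` onto `S` is `(α·y + (1 − α)·z, α²d²)` (it is a closest point, and the
unique one). -/
theorem stmt_3 (N : ℕ) (z y : EuclideanSpace ℝ (Fin N)) (ζ d β : ℝ)
    (hd : d = ‖y - z‖) (hζ : ζ < d ^ 2)
    (hβpos : 0 < β) (hβroot : 2 * β ^ 3 + (1 - 2 * ζ) * β - d = 0)
    (S : Set (WithLp 2 (EuclideanSpace ℝ (Fin N) × ℝ)))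
    (hS : S = {p | ‖(WithLp.equiv 2 (EuclideanSpace ℝ (Fin N) × ℝ) p).1 - z‖ ^ 2
      ≤ (WithLp.equiv 2 (EuclideanSpace ℝ (Fin N) × ℝ) p).2}) :
    IsMetricProj S ((WithLp.equiv 2 (EuclideanSpace ℝ (Fin N) × ℝ)).symm (y, ζ))
      ((WithLp.equiv 2 (EuclideanSpace ℝ (Fin N) × ℝ)).symm
        ((β / d) • y + (1 - β / d) • z, (β / d) ^ 2 * d ^ 2)) ∧
    ∀ w, IsMetricProj S ((WithLp.equiv 2 (EuclideanSpace ℝ (Fin N) × ℝ)).symm (y, ζ)) w →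
      w = (WithLp.equiv 2 (EuclideanSpace ℝ (Fin N) × ℝ)).symm
        ((β / d) • y + (1 - β / d) • z, (β / d) ^ 2 * d ^ 2) := by
  subst hS
  have hd0 : 0 ≤ d := hd ▸ norm_nonneg _
  have hlt : ζ < β ^ 2 := lt_sq_of_cubic_root hd0 hζ hβpos hβroot
  have hdpos : 0 < d := by nlinarith [mul_pos hβpos (sub_pos.2 hlt)]
  have hsq : (β / d) ^ 2 * d ^ 2 = β ^ 2 := by field_simp
  have hnormal : 1 - β / d = 2 * ((β / d) ^ 2 * d ^ 2 - ζ) * (β / d) := by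
    rw [hsq]
    field_simp
    linarith
  have hsub : (β / d) • y + (1 - β / d) • z - z = (β / d) • (y - z) := by module
  apply IsMetricProj.and_unique_of_sq_add_sq_le
  · simp only [Set.mem_ofPred_eq, Equiv.apply_symm_apply]
    rw [hsub, norm_smul, mul_pow, Real.norm_eq_abs, sq_abs, hd]
  · intro r hr
    have key := sq_add_sq_le_of_normal (y - z) (r.fst - z) (a := β / d) (by rw [← hd])
      (hsq ▸ hlt.le) hnormal hr
    have e1 : y - z - (β / d) • (y - z) = y - ((β / d) • y + (1 - β / d) • z) := by module
    have e2 : (β / d) • (y - z) - (r.fst - z) =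
      (β / d) • y + (1 - β / d) • z - r.fst := by module
    rw [e1, e2, sub_sub_sub_cancel_right] at key
    simp only [dist_eq_norm, WithLp.prod_norm_sq_eq_of_L2, Real.norm_eq_abs, sq_abs]
    exact key
end

section
/- Let ζ ∈ ℝ and d > 0 with d² > ζ, and let φ : ℝ → ℝ be defined by φ(t) = (1/2)(max{t² − ζ, 0})². Then the proximity operator of φ evaluated at d, i.e., the unique minimizer over x ∈ ℝ of φ(x) + (1/2)(x − d)², equals the unique positive real root of the cubic equation 2x³ + (1 − 2ζ)x − d = 0. -/
theorem exists_pos_root_cubic (ζ d : ℝ) (hd : 0 < d) (hζ : ζ < d ^ 2) :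
    ∃ r : ℝ, 0 < r ∧ ζ < r ^ 2 ∧ 2 * r ^ 3 + (1 - 2 * ζ) * r - d = 0 := by
  have hc : ContinuousOn (fun x : ℝ => 2 * x ^ 3 + (1 - 2 * ζ) * x - d) (Set.Icc 0 d) := by
    fun_prop
  have hv : (0 : ℝ) ∈ Set.Icc (2 * (0 : ℝ) ^ 3 + (1 - 2 * ζ) * 0 - d)
      (2 * d ^ 3 + (1 - 2 * ζ) * d - d) := by
    constructor
    · linarith
    · linarith [mul_pos hd (sub_pos.2 hζ)]
  obtain ⟨r, ⟨hr0, hrd⟩, hr⟩ := intermediate_value_Icc hd.le hc hv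
  have hr : 2 * r ^ 3 + (1 - 2 * ζ) * r - d = 0 := hr
  have hpos : 0 < r := by
    refine hr0.lt_of_ne ?_
    rintro rfl
    linarith
  refine ⟨r, hpos, ?_, hr⟩
  by_contra! h
  have hdr : d ≤ r := by linarith [mul_nonneg hr0 (sub_nonneg.2 h)]
  exact absurd (hζ.trans_le (pow_le_pow_left₀ hd.le hdr 2)) h.not_gt

/-- Quadratic growth of the prox objective around a positive root of the cubic. -/
theorem prox_objective_quadratic_growth {ζ d r : ℝ} (hζ : ζ < r ^ 2)
    (hr : 2 * r ^ 3 + (1 - 2 * ζ) * r - d = 0) (x : ℝ) :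
    (1 / 2) * max (r ^ 2 - ζ) 0 ^ 2 + (1 / 2) * (r - d) ^ 2 + (1 / 2) * (x - r) ^ 2
      ≤ (1 / 2) * max (x ^ 2 - ζ) 0 ^ 2 + (1 / 2) * (x - d) ^ 2 := by
  rw [max_eq_left (sub_pos.2 hζ).le]
  have hM : x ^ 2 - ζ ≤ max (x ^ 2 - ζ) 0 := le_max_left _ _
  generalize max (x ^ 2 - ζ) 0 = M at hM ⊢
  have hlin : 2 * r * (x - r) ≤ M - (r ^ 2 - ζ) := by linarith [sq_nonneg (x - r)]
  have hmul := mul_le_mul_of_nonneg_left hlin (sub_pos.2 hζ).le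
  obtain rfl : d = 2 * r ^ 3 + (1 - 2 * ζ) * r := by linarith
  linarith [sq_nonneg (M - (r ^ 2 - ζ))]

/-- For `ζ ∈ ℝ`, `d > 0` with `d² > ζ`, and
`φ(t) = (1/2)(max{t² − ζ, 0})²`, the proximity operator of `φ` at `d`, i.e. the
unique minimizer over `x ∈ ℝ` of `φ(x) + (1/2)(x − d)²`, exists, and it equals the
unique positive real root of `2x³ + (1 − 2ζ)x − d = 0`: every minimizer is a
positive root of this cubic. -/
theorem stmt_6 (ζ d : ℝ) (hd : 0 < d) (hζ : ζ < d ^ 2) :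
    (∃! p : ℝ, ∀ x : ℝ,
        (1 / 2) * max (p ^ 2 - ζ) 0 ^ 2 + (1 / 2) * (p - d) ^ 2
          ≤ (1 / 2) * max (x ^ 2 - ζ) 0 ^ 2 + (1 / 2) * (x - d) ^ 2) ∧
    ∀ p : ℝ,
      (∀ x : ℝ, (1 / 2) * max (p ^ 2 - ζ) 0 ^ 2 + (1 / 2) * (p - d) ^ 2
          ≤ (1 / 2) * max (x ^ 2 - ζ) 0 ^ 2 + (1 / 2) * (x - d) ^ 2) →
      0 < p ∧ 2 * p ^ 3 + (1 - 2 * ζ) * p - d = 0 := by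
  obtain ⟨r, hpos, hζr, hr⟩ := exists_pos_root_cubic ζ d hd hζ
  have hgrowth := prox_objective_quadratic_growth hζr hr
  have huniq : ∀ p : ℝ,
      (∀ x : ℝ, (1 / 2) * max (p ^ 2 - ζ) 0 ^ 2 + (1 / 2) * (p - d) ^ 2
          ≤ (1 / 2) * max (x ^ 2 - ζ) 0 ^ 2 + (1 / 2) * (x - d) ^ 2) → p = r := by
    intro p hp
    have hsq : (p - r) ^ 2 = 0 :=
      le_antisymm (by linarith [hp r, hgrowth p]) (sq_nonneg _)
    exact sub_eq_zero.1 (pow_eq_zero_iff two_ne_zero |>.1 hsq)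
  refine ⟨⟨r, fun x => by linarith [hgrowth x, sq_nonneg (x - r)], huniq⟩, fun p hp => ?_⟩
  rw [huniq p hp]
  exact ⟨hpos, hr⟩
end

section
/- Let z ∈ ℝ^N, let S = {(x, η) ∈ ℝ^N × ℝ : ‖x − z‖² ≤ η}, and let (y, ζ) ∈ ℝ^N × ℝ with y ≠ z. Set d := ‖y − z‖ and let p := prox_φ(d) be the unique minimizer over x ∈ ℝ of (1/2)(max{x² − ζ, 0})² + (1/2)(x − d)². Then the metric projection of (y, ζ) onto S equals (z + (p/d)(y − z), max{p², ζ}). -/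
/-- Metric projections onto convex sets of a real inner product space are unique. -/
theorem IsMetricProj.eq_of_convex {E : Type*} [NormedAddCommGroup E] [InnerProductSpace ℝ E]
    {S : Set E} (hS : Convex ℝ S) {u v w : E} (hv : IsMetricProj S u v)
    (hw : IsMetricProj S u w) : v = w := by
  have hvw : dist u v = dist u w := le_antisymm (hv.2 w hw.1) (hw.2 v hv.1)
  have hm : midpoint ℝ v w ∈ S := hS.midpoint_mem hv.1 hw.1
  have hle := hv.2 _ hm
  have hpar := parallelogram_law_with_norm ℝ (u - v) (u - w)
  have hsum : (u - v) + (u - w) = (2 : ℝ) • (u - midpoint ℝ v w) := by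
    rw [midpoint_eq_smul_add, invOf_eq_inv]
    module
  rw [hsum, norm_smul, Real.norm_two, sub_sub_sub_cancel_left] at hpar
  rw [dist_eq_norm, dist_eq_norm] at hvw hle
  rw [← hvw] at hpar
  have hzero : ‖w - v‖ = 0 := by
    have hsq := pow_le_pow_left₀ (norm_nonneg (u - v)) hle 2
    nlinarith [norm_nonneg (w - v)]
  exact (sub_eq_zero.mp (norm_eq_zero.mp hzero)).symm

/-- The epigraph of the squared distance to a point is convex. -/
theorem convex_epigraph_norm_sub_sq {E : Type*} [NormedAddCommGroup E] [NormedSpace ℝ E] (z : E) :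
    Convex ℝ {q : WithLp 2 (E × ℝ) | ‖q.fst - z‖ ^ 2 ≤ q.snd} := by
  intro q hq r hr a b ha hb hab
  simp only [Set.mem_ofPred_eq, WithLp.add_fst, WithLp.add_snd, WithLp.smul_fst,
    WithLp.smul_snd, smul_eq_mul] at *
  have hcomb : a • q.fst + b • r.fst - z = a • (q.fst - z) + b • (r.fst - z) := by
    obtain rfl : b = 1 - a := by linarith
    module
  have hnorm : ‖a • q.fst + b • r.fst - z‖ ≤ a * ‖q.fst - z‖ + b * ‖r.fst - z‖ := by
    rw [hcomb]
    refine (norm_add_le _ _).trans_eq ?_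
    rw [norm_smul, norm_smul, Real.norm_of_nonneg ha, Real.norm_of_nonneg hb]
  have hsq := (convexOn_pow 2).2 (norm_nonneg (q.fst - z)) (norm_nonneg (r.fst - z)) ha hb hab
  simp only [smul_eq_mul] at hsq
  calc _ ≤ (a * ‖q.fst - z‖ + b * ‖r.fst - z‖) ^ 2 := by gcongr
    _ ≤ _ := hsq
    _ ≤ _ := by gcongr

/-- The reduction of the projection onto the epigraph of the squared distance to a
one-dimensional minimization problem. -/
theorem isMetricProj_epigraph_norm_sub_sq {E : Type*} [NormedAddCommGroup E]
    [InnerProductSpace ℝ E] {z y : E} {ζ p : ℝ} (hyz : y ≠ z)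
    (hp : ∀ x : ℝ,
      (1 / 2) * max (p ^ 2 - ζ) 0 ^ 2 + (1 / 2) * (p - ‖y - z‖) ^ 2
        ≤ (1 / 2) * max (x ^ 2 - ζ) 0 ^ 2 + (1 / 2) * (x - ‖y - z‖) ^ 2) :
    IsMetricProj {q : WithLp 2 (E × ℝ) | ‖q.fst - z‖ ^ 2 ≤ q.snd} (WithLp.toLp 2 (y, ζ))
      (WithLp.toLp 2 (z + (p / ‖y - z‖) • (y - z), max (p ^ 2) ζ)) := by
  have hd : ‖y - z‖ ≠ 0 := norm_ne_zero_iff.mpr (sub_ne_zero.mpr hyz)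
  refine ⟨?_, fun r hr ↦ ?_⟩
  · simp [norm_smul, div_mul_cancel₀ _ hd]
  · rw [WithLp.prod_dist_eq_of_L2, WithLp.prod_dist_eq_of_L2]
    refine Real.sqrt_le_sqrt ?_
    simp only [Set.mem_ofPred_eq, WithLp.toLp_fst, WithLp.toLp_snd] at *
    have hfst : dist y (z + (p / ‖y - z‖) • (y - z)) ^ 2 = (p - ‖y - z‖) ^ 2 := by
      have : y - (z + (p / ‖y - z‖) • (y - z)) = (1 - p / ‖y - z‖) • (y - z) := by module
      rw [dist_eq_norm, this, norm_smul, mul_pow, Real.norm_eq_abs, sq_abs, ← mul_pow]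
      field_simp
      ring
    have hsnd : dist ζ (max (p ^ 2) ζ) ^ 2 = max (p ^ 2 - ζ) 0 ^ 2 := by
      rw [Real.dist_eq, sq_abs, ← sub_self ζ, max_sub_sub_right]
      ring
    have hr₁ : (‖r.fst - z‖ - ‖y - z‖) ^ 2 ≤ dist y r.fst ^ 2 := by
      rw [dist_comm, dist_eq_norm, ← sub_sub_sub_cancel_right r.fst y z, sq_le_sq, abs_norm]
      exact abs_norm_sub_norm_le _ _
    have hr₂ : max (‖r.fst - z‖ ^ 2 - ζ) 0 ^ 2 ≤ dist ζ r.snd ^ 2 := by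
      gcongr
      rw [dist_comm, Real.dist_eq]
      exact max_le ((sub_le_sub_right hr ζ).trans (le_abs_self _)) (abs_nonneg _)
    rw [hfst, hsnd]
    linarith [hp ‖r.fst - z‖]

/-- Let `S = {(x, η) : ‖x − z‖² ≤ η}`, let `y ≠ z`, `d := ‖y − z‖`,
and let `p = prox_φ(d)` be the (unique) minimizer over `x ∈ ℝ` of
`(1/2)(max{x² − ζ, 0})² + (1/2)(x − d)²`.  Then the metric projection of `(y, ζ)`
onto `S` equals `(z + (p/d)(y − z), max{p², ζ})` (it is a closest point, and the
unique one). -/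
theorem stmt_7 (N : ℕ) (z y : EuclideanSpace ℝ (Fin N)) (ζ p : ℝ)
    (hyz : y ≠ z)
    (hp : ∀ x : ℝ,
      (1 / 2) * max (p ^ 2 - ζ) 0 ^ 2 + (1 / 2) * (p - ‖y - z‖) ^ 2
        ≤ (1 / 2) * max (x ^ 2 - ζ) 0 ^ 2 + (1 / 2) * (x - ‖y - z‖) ^ 2)
    (S : Set (WithLp 2 (EuclideanSpace ℝ (Fin N) × ℝ)))
    (hS : S = {q | ‖(WithLp.equiv 2 (EuclideanSpace ℝ (Fin N) × ℝ) q).1 - z‖ ^ 2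
      ≤ (WithLp.equiv 2 (EuclideanSpace ℝ (Fin N) × ℝ) q).2}) :
    IsMetricProj S ((WithLp.equiv 2 (EuclideanSpace ℝ (Fin N) × ℝ)).symm (y, ζ))
      ((WithLp.equiv 2 (EuclideanSpace ℝ (Fin N) × ℝ)).symm
        (z + (p / ‖y - z‖) • (y - z), max (p ^ 2) ζ)) ∧
    ∀ w, IsMetricProj S ((WithLp.equiv 2 (EuclideanSpace ℝ (Fin N) × ℝ)).symm (y, ζ)) w →
      w = (WithLp.equiv 2 (EuclideanSpace ℝ (Fin N) × ℝ)).symm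
        (z + (p / ‖y - z‖) • (y - z), max (p ^ 2) ζ) := by
  subst hS
  have hproj := isMetricProj_epigraph_norm_sub_sq hyz hp
  exact ⟨hproj, fun w hw ↦ hw.eq_of_convex (convex_epigraph_norm_sub_sq z) hproj⟩
end
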